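/- For every n ≥ 1, the number of isomorphism classes of connected 3-leaf power simple graphs on n vertices is at most 2^(2n) = 4^n. -/

import Mathlib

/-- A vertex of a simple graph is a leaf if it has exactly one neighbour. -/
def IsLeafVert {V : Type} (T : SimpleGraph V) (v : V) : Prop :=
  ∃! u, T.Adj v u

/-- A simple graph `G` is a 3-leaf power if there are a finite tree `T` and a bijection
from the vertices of `G` onto the leaves of `T` such that two distinct vertices of `G`
are adjacent iff the corresponding leaves are at distance at most 3 in `T`. -/
def IsThreeLeafPower {V : Type} (G : SimpleGraph V) : Prop :=
  ∃ (m : ℕ) (T : SimpleGraph (Fin m)), T.IsTree ∧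
    ∃ f : V → Fin m,
      Function.Injective f ∧
      (∀ v : V, IsLeafVert T (f v)) ∧
      (∀ w : Fin m, IsLeafVert T w → ∃ v : V, f v = w) ∧
      (∀ x y : V, x ≠ y → (G.Adj x y ↔ T.dist (f x) (f y) ≤ 3))

/-- The number of isomorphism classes of connected 3-leaf power simple graphs
on `n` vertices. -/
noncomputable def numConn3LP (n : ℕ) : ℕ :=
  Nat.card (Quot (fun (G G' : {G : SimpleGraph (Fin n) // G.Connected ∧ IsThreeLeafPower G}) =>
    Nonempty (G.val ≃g G'.val)))

open Finset in
lemma prod_inv_one_sub_le_exp {X : Type*} (T : Finset X) (y : X → ℝ) (h0 : ∀ c ∈ T, 0 ≤ y c)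
    (h1 : ∀ c ∈ T, y c ≤ 1 / 16) :
    ∏ c ∈ T, (1 - y c)⁻¹ ≤ Real.exp (16 / 15 * ∑ c ∈ T, y c) := by
  rw [mul_sum, Real.exp_sum]
  refine prod_le_prod (fun c hc => ?_) fun c hc => ?_
  · have := h1 c hc
    exact inv_nonneg.2 (by linarith)
  · have hy0 := h0 c hc
    have hy1 := h1 c hc
    refine le_trans ?_ (Real.add_one_le_exp _)
    rw [inv_le_iff_one_le_mul₀ (by linarith)]
    nlinarith

lemma exp_four_fifths_le : Real.exp (4 / 5) ≤ 9 / 4 := by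
  refine le_of_pow_le_pow_left₀ (n := 5) (by norm_num) (by norm_num) ?_
  rw [← Real.exp_nat_mul]
  have h : Real.exp ((5 : ℕ) * (4 / 5)) = Real.exp 1 ^ 4 := by
    rw [← Real.exp_nat_mul]; norm_num
  rw [h]
  refine (pow_le_pow_left₀ (Real.exp_pos 1).le Real.exp_one_lt_d9.le 4).trans ?_
  norm_num

lemma exp_sixteen_fifteenths_le : Real.exp (16 / 15) ≤ 3 := by
  refine le_of_pow_le_pow_left₀ (n := 15) (by norm_num) (by norm_num) ?_
  rw [← Real.exp_nat_mul]
  have h : Real.exp ((15 : ℕ) * (16 / 15)) = Real.exp 1 ^ 16 := by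
    rw [← Real.exp_nat_mul]; norm_num
  rw [h]
  refine (pow_le_pow_left₀ (Real.exp_pos 1).le Real.exp_one_lt_d9.le 16).trans ?_
  norm_num

lemma quarter_pow_le_of_two_le {k : ℕ} (hk : 2 ≤ k) : (1 / 4 : ℝ) ^ k ≤ 1 / 16 :=
  (pow_le_pow_of_le_one (by norm_num) (by norm_num) hk).trans (by norm_num)

open Finset in
lemma prod_inv_one_sub_quarter_pow_le {X : Type*} (T : Finset X) (s : X → ℕ)
    (hpos : ∀ c ∈ T, 1 ≤ s c) (hone : ∀ c ∈ T, ∀ d ∈ T, s c = 1 → s d = 1 → c = d)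
    (hsum : ∑ c ∈ T, (1 / 4 : ℝ) ^ s c ≤ 1) :
    ∏ c ∈ T, (1 - (1 / 4 : ℝ) ^ s c)⁻¹ ≤ 3 := by
  classical
  by_cases h : ∃ c ∈ T, s c = 1
  · obtain ⟨c, hc, hc1⟩ := h
    rw [← mul_prod_erase T _ hc, hc1]
    rw [← add_sum_erase T _ hc, hc1] at hsum
    have key := prod_inv_one_sub_le_exp (T.erase c) (fun d => (1 / 4 : ℝ) ^ s d)
      (fun d _ => by positivity) fun d hd => by
        obtain ⟨hne, hd⟩ := mem_erase.1 hd
        refine quarter_pow_le_of_two_le ?_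
        have h1 := hpos d hd
        have h2 : s d ≠ 1 := fun h => hne (hone d hd c hc h hc1)
        omega
    have hexp : Real.exp (16 / 15 * ∑ d ∈ T.erase c, (1 / 4 : ℝ) ^ s d) ≤ 9 / 4 :=
      (Real.exp_le_exp.2 (by linarith)).trans exp_four_fifths_le
    have := key.trans hexp
    norm_num at this ⊢
    linarith
  · push Not at h
    refine (prod_inv_one_sub_le_exp T (fun d => (1 / 4 : ℝ) ^ s d) (fun d _ => by positivity)
      fun d hd => quarter_pow_le_of_two_le ?_).trans
      ((Real.exp_le_exp.2 (by linarith)).trans exp_sixteen_fifteenths_le)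
    have h1 := hpos d hd
    have h2 := h d hd
    omega

lemma sum_range_pow_le_inv_one_sub {y : ℝ} (h0 : 0 ≤ y) (h1 : y < 1) (n : ℕ) :
    ∑ j ∈ Finset.range n, y ^ j ≤ (1 - y)⁻¹ := by
  rw [← tsum_geometric_of_lt_one h0 h1]
  exact (summable_geometric_of_lt_one h0 h1).sum_le_tsum _ fun _ _ => by positivity

lemma sum_Icc_quarter_pow_le (N : ℕ) : ∑ j ∈ Finset.Icc 1 N, (1 / 4 : ℝ) ^ j ≤ 1 / 3 := by
  have h := sum_range_pow_le_inv_one_sub (y := 1 / 4) (by norm_num) (by norm_num) (N + 1)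
  rw [Finset.sum_range_succ', Finset.range_eq_Ico] at h
  have h2 : ∑ j ∈ Finset.Icc 1 N, (1 / 4 : ℝ) ^ j = ∑ k ∈ Finset.Ico 0 N, (1 / 4 : ℝ) ^ (k + 1) := by
    rw [Finset.sum_Ico_add' (fun k => (1 / 4 : ℝ) ^ k) 0 N 1]
    rfl
  rw [h2]
  norm_num at h ⊢
  linarith

/-- A Kraft-type inequality for unordered rooted trees whose nodes carry positive integer weights:
if an element of `X` is determined by its root weight `w` and its multiset `ch` of children, and
`s` is the total weight, then the elements `x` contribute at most `1` to `∑ 4⁻ˢ⁽ˣ⁾`. -/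
theorem sum_quarter_pow_le_one {X : Type*} (s w : X → ℕ) (ch : X → Multiset X)
    (hs : ∀ x, s x = w x + ((ch x).map s).sum) (hw : ∀ x, 1 ≤ w x)
    (hinj : ∀ x y, w x = w y → ch x = ch y → x = y) (S : Finset X) :
    ∑ x ∈ S, (1 / 4 : ℝ) ^ s x ≤ 1 := by
  classical
  have hpos : ∀ x, 1 ≤ s x := fun x => by rw [hs]; exact (hw x).trans (Nat.le_add_right _ _)
  have hchild : ∀ x, ∀ c ∈ ch x, s c < s x := fun x c hc => by
    have := Multiset.le_sum_of_mem (Multiset.mem_map_of_mem s hc)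
    have := hw x
    rw [hs x]
    omega
  have hone : ∀ x y, s x = 1 → s y = 1 → x = y := by
    have aux : ∀ x, s x = 1 → w x = 1 ∧ ch x = 0 := fun x hx => by
      refine ⟨?_, Multiset.eq_zero_of_forall_notMem fun c hc => ?_⟩
      · have := hs x
        have := hw x
        omega
      · have := hchild x c hc
        have := hpos c
        omega
    exact fun x y hx hy => hinj x y ((aux x hx).1.trans (aux y hy).1.symm)
      ((aux x hx).2.trans (aux y hy).2.symm)
  suffices H : ∀ N, ∀ S : Finset X, (∀ x ∈ S, s x ≤ N) → ∑ x ∈ S, (1 / 4 : ℝ) ^ s x ≤ 1 from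
    H (S.sup s) S fun x hx => Finset.le_sup hx
  intro N
  induction N with
  | zero =>
    intro S hS
    have : S = ∅ := Finset.eq_empty_of_forall_notMem fun x hx => by
      have := hS x hx
      have := hpos x
      omega
    simp [this]
  | succ N ih =>
    intro S hS
    set T : Finset X := S.biUnion fun x => (ch x).toFinset
    have hTN : ∀ c ∈ T, s c ≤ N := fun c hc => by
      obtain ⟨x, hx, hcx⟩ := Finset.mem_biUnion.1 hc
      have := hchild x c (Multiset.mem_toFinset.1 hcx)
      have := hS x hx
      omega
    have hsub : ∀ x ∈ S, ∀ c ∈ ch x, c ∈ T := fun x hx c hc =>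
      Finset.mem_biUnion.2 ⟨x, hx, Multiset.mem_toFinset.2 hc⟩
    have hsx : ∀ x ∈ S, s x = w x + ∑ c : T, (ch x).count c.1 * s c.1 := fun x hx => by
      rw [hs x, Finset.sum_multiset_map_count,
        Finset.sum_coe_sort T fun c => (ch x).count c * s c]
      congr 1
      refine Finset.sum_subset (fun c hc => hsub x hx c (Multiset.mem_toFinset.1 hc))
        fun c _ hc => ?_
      rw [Multiset.count_eq_zero_of_notMem (by simpa using hc), zero_smul]
    have hcount : ∀ x ∈ S, ∀ c : T, (ch x).count c.1 < N + 2 := fun x hx c => by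
      have h1 := Finset.single_le_sum (f := fun c : T => (ch x).count c.1 * s c.1)
        (fun _ _ => Nat.zero_le _) (Finset.mem_univ c)
      have h2 := Nat.le_mul_of_pos_right ((ch x).count c.1) (hpos c.1)
      have h3 := hS x hx
      have h4 := hsx x hx
      omega
    let P := Finset.Icc 1 (N + 1) ×ˢ Fintype.piFinset fun _ : T => Finset.range (N + 2)
    let F : ℕ × (T → ℕ) → ℝ := fun p => (1 / 4) ^ p.1 * ∏ c : T, ((1 / 4) ^ s c.1) ^ p.2 c
    let D : X → ℕ × (T → ℕ) := fun x => (w x, fun c => (ch x).count c.1)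
    have hD : Set.InjOn D S := fun x hx y hy hxy => by
      have h1 : w x = w y := congrArg Prod.fst hxy
      have h2 := congrFun (congrArg Prod.snd hxy)
      refine hinj x y h1 (Multiset.ext.2 fun c => ?_)
      by_cases hc : c ∈ T
      · exact h2 ⟨c, hc⟩
      · rw [Multiset.count_eq_zero_of_notMem fun h => hc (hsub x hx c h),
          Multiset.count_eq_zero_of_notMem fun h => hc (hsub y hy c h)]
    have hDP : S.image D ⊆ P := by
      intro p hp
      obtain ⟨x, hx, rfl⟩ := Finset.mem_image.1 hp
      refine Finset.mem_product.2 ⟨Finset.mem_Icc.2 ⟨hw x, ?_⟩, Fintype.mem_piFinset.2 fun c =>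
        Finset.mem_range.2 (hcount x hx c)⟩
      exact (le_trans (Nat.le_add_right _ _) (hs x).ge).trans (hS x hx)
    have hF : ∀ x ∈ S, (1 / 4 : ℝ) ^ s x = F (D x) := fun x hx => by
      rw [hsx x hx, pow_add, ← Finset.prod_pow_eq_pow_sum]
      simp only [F, D, ← pow_mul, mul_comm]
    calc ∑ x ∈ S, (1 / 4 : ℝ) ^ s x = ∑ p ∈ S.image D, F p := by
          rw [Finset.sum_image hD]
          exact Finset.sum_congr rfl hF
      _ ≤ ∑ p ∈ P, F p :=
          Finset.sum_le_sum_of_subset_of_nonneg hDP fun _ _ _ => by positivity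
      _ = (∑ j ∈ Finset.Icc 1 (N + 1), (1 / 4 : ℝ) ^ j) *
            ∏ c : T, ∑ j ∈ Finset.range (N + 2), ((1 / 4 : ℝ) ^ s c.1) ^ j := by
          rw [Finset.prod_univ_sum, Finset.sum_mul_sum, Finset.sum_product]
      _ ≤ 1 / 3 * ∏ c : T, (1 - (1 / 4 : ℝ) ^ s c.1)⁻¹ := by
          refine mul_le_mul (sum_Icc_quarter_pow_le _) (Finset.prod_le_prod
            (fun _ _ => Finset.sum_nonneg fun _ _ => by positivity) fun c _ =>
            sum_range_pow_le_inv_one_sub (by positivity) ?_ _)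
            (Finset.prod_nonneg fun _ _ => Finset.sum_nonneg fun _ _ => by positivity)
            (by norm_num)
          exact pow_lt_one₀ (by norm_num) (by norm_num) (Nat.one_le_iff_ne_zero.1 (hpos c.1))
      _ ≤ 1 / 3 * 3 := by
          refine mul_le_mul_of_nonneg_left ?_ (by norm_num)
          rw [Finset.prod_coe_sort T fun c => (1 - (1 / 4 : ℝ) ^ s c)⁻¹]
          exact prod_inv_one_sub_quarter_pow_le T s (fun c _ => hpos c)
            (fun c _ d _ => hone c d) (ih T hTN)
      _ = 1 := by norm_num

lemma exists_equiv_of_map_univ_eq {α β γ : Type*} [Fintype α] [Fintype β] {f : α → γ} {g : β → γ}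
    (h : Multiset.map f Finset.univ.val = Multiset.map g Finset.univ.val) :
    ∃ e : α ≃ β, ∀ a, g (e a) = f a := by
  classical
  have hcard : ∀ c, Fintype.card {a // f a = c} = Fintype.card {b // g b = c} := fun c => by
    have := congrArg (Multiset.count c) h
    rw [Multiset.count_map, Multiset.count_map] at this
    rw [Fintype.card_subtype, Fintype.card_subtype]
    simpa only [eq_comm, Finset.card_def, Finset.filter_val] using this
  refine ⟨(Equiv.sigmaFiberEquiv f).symm.trans ((Equiv.sigmaCongrRight fun c =>
    Fintype.equivOfCardEq (hcard c)).trans (Equiv.sigmaFiberEquiv g)), fun a => ?_⟩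
  exact (Fintype.equivOfCardEq (hcard (f a)) ⟨a, rfl⟩).2

/-- `G` is connected and arises from a forest by blowing up its nodes into (possibly empty)
cliques, the nonempty set `B` being one of these cliques. -/
def IsRootedBlowup {V : Type} (G : SimpleGraph V) (B : Set V) : Prop :=
  G.Connected ∧ B.Nonempty ∧ ∃ (U : Type) (H : SimpleGraph U) (π : V → U) (u : U),
    H.IsAcyclic ∧ B = π ⁻¹' {u} ∧ ∀ x y, G.Adj x y ↔ x ≠ y ∧ (π x = π y ∨ H.Adj (π x) (π y))

namespace IsRootedBlowup

variable {V : Type} {G : SimpleGraph V} {B : Set V}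

lemma adj_of_mem (h : IsRootedBlowup G B) {a b : V} (ha : a ∈ B) (hb : b ∈ B) :
    G.Adj a b ↔ a ≠ b := by
  obtain ⟨-, -, U, H, π, u, -, rfl, hadj⟩ := h
  rw [hadj, and_iff_left]
  exact Or.inl (ha.trans hb.symm)

lemma adj_iff_of_notMem (h : IsRootedBlowup G B) {a v : V} (ha : a ∈ B) (hv : v ∉ B) :
    G.Adj a v ↔ ∃ b ∈ B, G.Adj b v := by
  obtain ⟨-, -, U, H, π, u, -, rfl, hadj⟩ := h
  refine ⟨fun h => ⟨a, ha, h⟩, ?_⟩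
  rintro ⟨b, hb, hbv⟩
  rw [hadj] at hbv ⊢
  have ha' : π a = u := ha
  have hb' : π b = u := hb
  rw [ha', ← hb']
  exact ⟨fun h => hv (h ▸ ha), hbv.2⟩

/-- The root clique of a component of the graph obtained by deleting the root clique `B`. -/
def childRoot (G : SimpleGraph V) (B : Set V) (C : (G.induce Bᶜ).ConnectedComponent) :
    Set C.supp :=
  {v | ∃ b ∈ B, G.Adj b v.1.1}

lemma childRoot_nonempty (hG : G.Connected) (hB : B.Nonempty)
    (C : (G.induce Bᶜ).ConnectedComponent) : (childRoot G B C).Nonempty := by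
  obtain ⟨v, hv⟩ := C.nonempty_supp
  obtain ⟨b, hb⟩ := hB
  obtain ⟨p⟩ := hG.preconnected v.1 b
  obtain ⟨d, -, ⟨x, hx, hxd⟩, hd⟩ := p.exists_boundary_dart (Subtype.val '' C.supp) ⟨v, hv, rfl⟩
    (by rintro ⟨x, -, rfl⟩; exact x.2 hb)
  refine ⟨⟨x, hx⟩, d.snd, ?_, hxd ▸ d.adj.symm⟩
  by_contra hdB
  refine hd ⟨⟨d.snd, hdB⟩, ?_, rfl⟩
  refine (C.mem_supp_congr_adj (v := x) ?_).1 hx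
  have := d.adj
  rwa [← hxd] at this

/-- The components left after deleting the root clique are again rooted blow-ups. -/
lemma child (h : IsRootedBlowup G B) (C : (G.induce Bᶜ).ConnectedComponent) :
    IsRootedBlowup ((G.induce Bᶜ).induce C.supp) (childRoot G B C) := by
  have hconn : ((G.induce Bᶜ).induce C.supp).Connected := C.connected_toSimpleGraph
  obtain ⟨x₀, hx₀⟩ := childRoot_nonempty h.1 h.2.1 C
  refine ⟨hconn, ⟨x₀, hx₀⟩, ?_⟩
  obtain ⟨-, -, U, H, π, u, hH, rfl, hadj⟩ := h
  refine ⟨U, H, fun v => π v.1.1, π x₀.1.1, hH, ?_, fun x y => ?_⟩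
  · have hroot : ∀ v ∈ childRoot G (π ⁻¹' {u}) C, H.Adj u (π v.1.1) := by
      rintro v ⟨b, hb, hbv⟩
      have hb' : π b = u := hb
      rw [hadj, hb'] at hbv
      exact hbv.2.resolve_left fun h => v.1.2 h.symm
    ext v
    constructor
    · intro hv
      change π v.1.1 = π x₀.1.1
      by_contra hne
      have hbr := SimpleGraph.isAcyclic_iff_forall_adj_isBridge.1 hH (hroot v hv)
      rw [SimpleGraph.isBridge_iff] at hbr
      refine hbr (SimpleGraph.Reachable.trans (v := π x₀.1.1) (SimpleGraph.Adj.reachable ?_) ?_)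
      · rw [SimpleGraph.deleteEdges_adj]
        refine ⟨hroot x₀ hx₀, ?_⟩
        simp only [Set.mem_singleton_iff, Sym2.eq_iff]
        rintro (h | h)
        · exact hne h.2.symm
        · exact x₀.1.2 h.2
      · have hstep : ∀ a b : C.supp, ((G.induce (π ⁻¹' {u})ᶜ).induce C.supp).Adj a b →
            (H.deleteEdges {s(u, π v.1.1)}).Reachable (π a.1.1) (π b.1.1) := fun a b hab => by
          rcases ((hadj a.1.1 b.1.1).1 hab).2 with h | h
          · rw [h]
          · refine SimpleGraph.Adj.reachable ?_
            rw [SimpleGraph.deleteEdges_adj]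
            refine ⟨h, ?_⟩
            simp only [Set.mem_singleton_iff, Sym2.eq_iff]
            rintro (h | h)
            · exact a.1.2 h.1
            · exact b.1.2 h.2
        have hwalk : ∀ a b : C.supp, ((G.induce (π ⁻¹' {u})ᶜ).induce C.supp).Walk a b →
            (H.deleteEdges {s(u, π v.1.1)}).Reachable (π a.1.1) (π b.1.1) := fun a b p => by
          induction p with
          | nil => rfl
          | cons hab _ ih => exact (hstep _ _ hab).trans ih
        exact hwalk x₀ v (hconn.preconnected x₀ v).some
    · intro hv
      obtain ⟨b, hb, hbv⟩ := hx₀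
      refine ⟨b, hb, ?_⟩
      have hv' : π v.1.1 = π x₀.1.1 := hv
      rw [hadj] at hbv ⊢
      rw [hv']
      exact ⟨fun h => v.1.2 (h ▸ hb), hbv.2⟩
  · refine (hadj x.1.1 y.1.1).trans ?_
    simp [Subtype.ext_iff]

/-- Rooted blow-ups with equally large root cliques and isomorphic children are isomorphic. -/
lemma nonempty_iso {V' : Type} {G' : SimpleGraph V'} {B' : Set V'} (h : IsRootedBlowup G B)
    (h' : IsRootedBlowup G' B') (eB : B ≃ B')
    (e : (G.induce Bᶜ).ConnectedComponent ≃ (G'.induce B'ᶜ).ConnectedComponent)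
    (φ : ∀ C, (G.induce Bᶜ).induce C.supp ≃g (G'.induce B'ᶜ).induce (e C).supp)
    (hφ : ∀ C v, v ∈ childRoot G B C ↔ φ C v ∈ childRoot G' B' (e C)) :
    ∃ f : G ≃g G', ∀ v, v ∈ B ↔ f v ∈ B' := by
  classical
  let j : B ⊕ (Σ C : (G.induce Bᶜ).ConnectedComponent, C.supp) ≃ V :=
    (Equiv.sumCongr (Equiv.refl _)
      (Equiv.sigmaFiberEquiv (G.induce Bᶜ).connectedComponentMk)).trans (Equiv.Set.sumCompl B)
  let j' : B' ⊕ (Σ C : (G'.induce B'ᶜ).ConnectedComponent, C.supp) ≃ V' :=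
    (Equiv.sumCongr (Equiv.refl _)
      (Equiv.sigmaFiberEquiv (G'.induce B'ᶜ).connectedComponentMk)).trans (Equiv.Set.sumCompl B')
  let k : B ⊕ (Σ C : (G.induce Bᶜ).ConnectedComponent, C.supp) ≃
      B' ⊕ (Σ C : (G'.induce B'ᶜ).ConnectedComponent, C.supp) :=
    Equiv.sumCongr eB (Equiv.sigmaCongr e fun C => (φ C).toEquiv)
  have hjl : ∀ b, j (Sum.inl b) = b.1 := fun _ => rfl
  have hjr : ∀ C v, j (Sum.inr ⟨C, v⟩) = v.1.1 := fun _ _ => rfl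
  have hjl' : ∀ b, j' (Sum.inl b) = b.1 := fun _ => rfl
  have hjr' : ∀ C v, j' (Sum.inr ⟨C, v⟩) = v.1.1 := fun _ _ => rfl
  have hkl : ∀ b, k (Sum.inl b) = Sum.inl (eB b) := fun _ => rfl
  have hkr : ∀ C v, k (Sum.inr ⟨C, v⟩) = Sum.inr ⟨e C, φ C v⟩ := fun _ _ => rfl
  have hmixed : ∀ (b : B) C (v : C.supp), G'.Adj (eB b).1 (φ C v).1.1 ↔ G.Adj b.1 v.1.1 :=
    fun b C v => by
      rw [h.adj_iff_of_notMem b.2 v.1.2, h'.adj_iff_of_notMem (eB b).2 (φ C v).1.2]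
      exact (hφ C v).symm
  have hadj : ∀ a b, G'.Adj (j' (k a)) (j' (k b)) ↔ G.Adj (j a) (j b) := by
    rintro (a | ⟨C, v⟩) (b | ⟨D, w⟩)
    · rw [hkl, hkl, hjl', hjl', hjl, hjl, h.adj_of_mem a.2 b.2,
        h'.adj_of_mem (eB a).2 (eB b).2]
      simp [← Subtype.ext_iff]
    · rw [hkl, hkr, hjl', hjr', hjl, hjr]
      exact hmixed a D w
    · rw [hkl, hkr, hjl', hjr', hjl, hjr, G.adj_comm, G'.adj_comm]
      exact hmixed b C v
    · rw [hkr, hkr, hjr', hjr', hjr, hjr]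
      by_cases hCD : C = D
      · subst hCD
        exact (φ C).map_rel_iff
      · refine iff_of_false (fun hvw => ?_) fun hvw => ?_
        · refine hCD (e.injective ?_)
          exact (φ C v).2.symm.trans ((SimpleGraph.ConnectedComponent.connectedComponentMk_eq_of_adj
            (G := G'.induce B'ᶜ) hvw).trans (φ D w).2)
        · exact hCD (v.2.symm.trans
            ((SimpleGraph.ConnectedComponent.connectedComponentMk_eq_of_adj
              (G := G.induce Bᶜ) hvw).trans w.2))
  refine ⟨⟨j.symm.trans (k.trans j'), fun {a b} => ?_⟩, fun v => ?_⟩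
  · simpa using hadj (j.symm a) (j.symm b)
  · obtain ⟨x, rfl⟩ := j.surjective v
    have hv : (j.symm.trans (k.trans j')) (j x) = j' (k x) := by simp
    change j x ∈ B ↔ (j.symm.trans (k.trans j')) (j x) ∈ B'
    rw [hv]
    rcases x with b | ⟨C, v⟩
    · exact iff_of_true b.2 (eB b).2
    · exact iff_of_false v.1.2 (φ C v).1.2

end IsRootedBlowup

/-- A finite rooted blow-up of a forest. -/
structure RootedBlowup : Type 1 where
  /-- The vertices. -/
  V : Type
  finite : Finite V
  /-- The graph. -/
  G : SimpleGraph V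
  /-- The root clique. -/
  B : Set V
  isRootedBlowup : IsRootedBlowup G B

namespace RootedBlowup

/-- Isomorphism of rooted blow-ups. -/
instance setoid : Setoid RootedBlowup where
  r R S := ∃ f : R.G ≃g S.G, ∀ v, v ∈ R.B ↔ f v ∈ S.B
  iseqv :=
    { refl := fun _ => ⟨.refl, fun _ => Iff.rfl⟩
      symm := fun ⟨f, hf⟩ => ⟨f.symm, fun v => by simp [hf]⟩
      trans := fun ⟨f, hf⟩ ⟨g, hg⟩ => ⟨f.trans g, fun v => (hf v).trans (hg (f v))⟩ }

/-- Isomorphism classes of rooted blow-ups. -/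
abbrev Class : Type 1 := Quotient setoid

instance (R : RootedBlowup) : Finite R.V := R.finite

/-- The child of a rooted blow-up on a component of the complement of the root clique. -/
def child (R : RootedBlowup) (C : (R.G.induce R.Bᶜ).ConnectedComponent) : RootedBlowup where
  V := C.supp
  finite := inferInstance
  G := (R.G.induce R.Bᶜ).induce C.supp
  B := IsRootedBlowup.childRoot R.G R.B C
  isRootedBlowup := R.isRootedBlowup.child C

/-- The isomorphism classes of the children of a rooted blow-up. -/
noncomputable def children (R : RootedBlowup) : Multiset Class :=
  let _ := Fintype.ofFinite (R.G.induce R.Bᶜ).ConnectedComponent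
  Finset.univ.val.map fun C => (⟦R.child C⟧ : Class)

/-- The number of vertices of any representative of an isomorphism class. -/
noncomputable def order : Class → ℕ :=
  Quotient.lift (fun R => Nat.card R.V) fun _ _ ⟨f, _⟩ => Nat.card_congr f.toEquiv

lemma card_eq_add_sum_children (R : RootedBlowup) :
    Nat.card R.V = Nat.card R.B + (R.children.map order).sum := by
  classical
  let _ := Fintype.ofFinite (R.G.induce R.Bᶜ).ConnectedComponent
  have h1 : Nat.card R.V = Nat.card R.B + Nat.card (R.Bᶜ : Set R.V) := by
    rw [← Nat.card_sum]
    exact (Nat.card_congr (Equiv.Set.sumCompl R.B)).symm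
  have h2 : Nat.card (R.Bᶜ : Set R.V) =
      ∑ C : (R.G.induce R.Bᶜ).ConnectedComponent, Nat.card C.supp := by
    rw [← Nat.card_sigma]
    exact (Nat.card_congr
      (Equiv.sigmaFiberEquiv (R.G.induce R.Bᶜ).connectedComponentMk)).symm
  rw [h1, h2, children, Multiset.map_map]
  congr 1

lemma equiv_of_children_eq {R S : RootedBlowup} (hB : Nat.card R.B = Nat.card S.B)
    (hch : R.children = S.children) : R ≈ S := by
  let _ := Fintype.ofFinite (R.G.induce R.Bᶜ).ConnectedComponent
  let _ := Fintype.ofFinite (S.G.induce S.Bᶜ).ConnectedComponent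
  obtain ⟨e, he⟩ := exists_equiv_of_map_univ_eq (f := fun C => (⟦R.child C⟧ : Class))
    (g := fun C => (⟦S.child C⟧ : Class)) hch
  have hiso : ∀ C, R.child C ≈ S.child (e C) := fun C => Quotient.exact (he C).symm
  choose φ hφ using hiso
  exact R.isRootedBlowup.nonempty_iso S.isRootedBlowup (Finite.card_eq.1 hB).some e φ hφ

lemma sum_quarter_pow_order_le_one (S : Finset Class) :
    ∑ c ∈ S, (1 / 4 : ℝ) ^ order c ≤ 1 := by
  refine sum_quarter_pow_le_one order (fun c => Nat.card c.out.B) (fun c => c.out.children)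
    (fun c => ?_) (fun c => ?_) (fun c d hB hch => ?_) S
  · rw [← card_eq_add_sum_children]
    conv_lhs => rw [← c.out_eq]
    rfl
  · have := c.out.isRootedBlowup.2.1.to_subtype
    exact Nat.card_pos
  · rw [← c.out_eq, ← d.out_eq]
    exact Quotient.sound (equiv_of_children_eq hB hch)

lemma card_le_four_pow {n : ℕ} (S : Finset Class) (hS : ∀ c ∈ S, order c = n) :
    S.card ≤ 4 ^ n := by
  have h := sum_quarter_pow_order_le_one S
  rw [Finset.sum_congr rfl fun c hc => by rw [hS c hc], Finset.sum_const, nsmul_eq_mul,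
    one_div, inv_pow, ← div_eq_mul_inv, div_le_one (by positivity)] at h
  exact_mod_cast h

end RootedBlowup

lemma eq_or_adj_of_length_le_three {V : Type*} {T : SimpleGraph V} {a b a' b' : V}
    (ha : ∀ c, T.Adj a c → c = a') (hb : ∀ c, T.Adj b c → c = b') (hab : a ≠ b)
    (p : T.Walk a b) (hp : p.length ≤ 3) : a' = b' ∨ T.Adj a' b' := by
  rcases p with _ | ⟨h₁, _ | ⟨h₂, _ | ⟨h₃, _ | ⟨h₄, q⟩⟩⟩⟩
  · exact absurd rfl hab
  · rw [← ha _ h₁, ← hb _ h₁.symm]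
    exact Or.inr h₁.symm
  · exact Or.inl ((ha _ h₁).symm.trans (hb _ h₂.symm))
  · rw [← ha _ h₁, ← hb _ h₃.symm]
    exact Or.inr h₂
  · simp only [SimpleGraph.Walk.length_cons] at hp
    omega

lemma IsThreeLeafPower.exists_blowup {V : Type} {G : SimpleGraph V} (h : IsThreeLeafPower G) :
    ∃ (U : Type) (H : SimpleGraph U) (π : V → U), H.IsAcyclic ∧
      ∀ x y, G.Adj x y ↔ x ≠ y ∧ (π x = π y ∨ H.Adj (π x) (π y)) := by
  obtain ⟨m, T, hT, f, hf, hleaf, -, hadj⟩ := h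
  choose π hπ huniq using hleaf
  refine ⟨Fin m, T, π, hT.isAcyclic, fun x y => ?_⟩
  by_cases hxy : x = y
  · subst hxy
    simp
  rw [hadj x y hxy, and_iff_right hxy]
  constructor
  · intro hd
    obtain ⟨p, hp⟩ := hT.connected.exists_walk_length_eq_dist (f x) (f y)
    rw [← hp] at hd
    exact eq_or_adj_of_length_le_three (huniq x) (huniq y) (fun h => hxy (hf h)) p hd
  · rintro (h | h)
    · have hy := (hπ y).symm
      rw [← h] at hy
      exact (SimpleGraph.dist_le (.cons (hπ x) (.cons hy .nil))).trans (by simp)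
    · exact (SimpleGraph.dist_le (.cons (hπ x) (.cons h (.cons (hπ y).symm .nil)))).trans
        (by simp)

theorem numConn3LP_le_two_pow_two_n :
    ∀ n : ℕ, 1 ≤ n → numConn3LP n ≤ 2 ^ (2 * n) := by
  intro n _
  classical
  rw [pow_mul, numConn3LP]
  norm_num only
  have hroot : ∀ G : {G : SimpleGraph (Fin n) // G.Connected ∧ IsThreeLeafPower G},
      ∃ B, IsRootedBlowup G.1 B := fun G => by
    obtain ⟨U, H, π, hH, hadj⟩ := G.2.2.exists_blowup
    obtain ⟨v⟩ := G.2.1.nonempty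
    exact ⟨π ⁻¹' {π v}, G.2.1, ⟨v, rfl⟩, U, H, π, π v, hH, rfl, hadj⟩
  choose B hB using hroot
  let R : {G : SimpleGraph (Fin n) // G.Connected ∧ IsThreeLeafPower G} → RootedBlowup := fun G =>
    { V := Fin n, finite := inferInstance, G := G.1, B := B G, isRootedBlowup := hB G }
  have : Finite (Quot fun G G' : {G : SimpleGraph (Fin n) // G.Connected ∧ IsThreeLeafPower G} =>
    Nonempty (G.val ≃g G'.val)) := Quot.finite _
  let _ := Fintype.ofFinite (Quot fun G G' :
    {G : SimpleGraph (Fin n) // G.Connected ∧ IsThreeLeafPower G} => Nonempty (G.val ≃g G'.val))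
  rw [Nat.card_eq_fintype_card, ← Finset.card_univ,
    ← Finset.card_image_of_injective (f := fun q => (⟦R q.out⟧ : RootedBlowup.Class)) _ ?_]
  · refine RootedBlowup.card_le_four_pow _ fun c hc => ?_
    obtain ⟨q, -, rfl⟩ := Finset.mem_image.1 hc
    exact Nat.card_fin n
  · intro q q' h
    obtain ⟨f, -⟩ := Quotient.exact h
    rw [← q.out_eq, ← q'.out_eq]
    exact Quot.sound ⟨f⟩
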